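/- Let α, B1, B2, P̄1, P̄2, L̄1, L̄2, Ts, δc, M1, M2, L1, L2 be positive reals with L̄1 ≤ L̄2, and set α1 = α2 = α (equal channel gains). Suppose (P11*, P21*, P23*, R11*, R21*, R23*, γ11*, γ21*, γ23*) is a global minimizer of the full multiple access partial offloading problem and P11* + P21* ≤ min(P̄1, P̄2). Then there exists a feasible point (P1, P2, R1, R2, γ1, γ2) of the TDMA partial offloading problem with γ1 = γ11* and γ2 = γ21* + γ23* whose total energy objective is at most the optimal value of the full multiple access partial offloading problem. (Proposition 3: with equal channel gains and power budgets above the stated threshold, TDMA achieves the optimal energy of full multiple access partial offloading, with the same offloaded fractions.) -/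

import Mathlib

/-- Base-2 logarithm. -/
noncomputable def log2 (x : ℝ) : ℝ := Real.logb 2 x

/-- Feasible set of the full multiple access partial offloading problem. -/
def FMPFeas (α1 α2 B1 B2 Pb1 Pb2 Lb1 Lb2 Ts δc
    P11 P21 P23 R11 R21 R23 γ11 γ21 γ23 : ℝ) : Prop :=
  0 ≤ γ11 ∧ γ11 ≤ 1 ∧ 0 ≤ γ21 ∧ 0 ≤ γ23 ∧ γ21 + γ23 ≤ 1 ∧
  0 < R11 ∧ 0 < R21 ∧ 0 < R23 ∧
  γ11 * B1 / R11 = γ21 * B2 / R21 ∧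
  Ts * (γ11 * B1 / R11) + δc * γ11 * B1 ≤ Lb1 ∧
  Ts * (γ21 * B2 / R21 + γ23 * B2 / R23) + δc * (γ21 + γ23) * B2 ≤ Lb2 ∧
  0 ≤ P11 ∧ P11 ≤ Pb1 ∧ 0 ≤ P21 ∧ P21 ≤ Pb2 ∧ 0 ≤ P23 ∧ P23 ≤ Pb2 ∧
  R11 ≤ log2 (1 + α1 * P11) ∧ R21 ≤ log2 (1 + α2 * P21) ∧
  R11 + R21 ≤ log2 (1 + α1 * P11 + α2 * P21) ∧ R23 ≤ log2 (1 + α2 * P23)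

/-- Objective of the full multiple access partial offloading problem
(transmission energy plus local computation energy). -/
noncomputable def FMPObj (B1 B2 M1 M2 L1 L2 P11 P21 P23 R11 R21 R23 γ11 γ21 γ23 : ℝ) : ℝ :=
  (γ11 * B1 / R11) * (P11 + P21) + (γ23 * B2 / R23) * P23 +
    (M1 / L1 ^ 2) * ((1 - γ11) * B1) ^ 3 + (M2 / L2 ^ 2) * ((1 - γ21 - γ23) * B2) ^ 3

/-- Feasible set of the TDMA partial offloading problem. -/
def TPFeas (α1 α2 B1 B2 Pb1 Pb2 Lb1 Lb2 Ts δc P1 P2 R1 R2 γ1 γ2 : ℝ) : Prop :=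
  0 ≤ γ1 ∧ γ1 ≤ 1 ∧ 0 ≤ γ2 ∧ γ2 ≤ 1 ∧
  0 ≤ P1 ∧ P1 ≤ Pb1 ∧ 0 ≤ P2 ∧ P2 ≤ Pb2 ∧
  0 < R1 ∧ R1 ≤ log2 (1 + α1 * P1) ∧ 0 < R2 ∧ R2 ≤ log2 (1 + α2 * P2) ∧
  Ts * (γ1 * B1 / R1) + δc * γ1 * B1 ≤ Lb1 ∧
  Ts * (γ1 * B1 / R1) + Ts * (γ2 * B2 / R2) + δc * γ2 * B2 ≤ Lb2

/-- Objective of the TDMA partial offloading problem. -/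
noncomputable def TPObj (B1 B2 M1 M2 L1 L2 P1 P2 R1 R2 γ1 γ2 : ℝ) : ℝ :=
  (γ1 * B1 / R1) * P1 + (γ2 * B2 / R2) * P2 +
    (M1 / L1 ^ 2) * ((1 - γ1) * B1) ^ 3 + (M2 / L2 ^ 2) * ((1 - γ2) * B2) ^ 3

set_option maxHeartbeats 1000000 in
/-- Proposition 3: with equal channel gains and power budgets above the stated threshold,
TDMA achieves the optimal energy of full multiple access partial offloading, with the same
offloaded fractions γ1 = γ11*, γ2 = γ21* + γ23*. -/
theorem tdma_achieves_fullMA_partial_equal_gains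
    (α B1 B2 Pb1 Pb2 Lb1 Lb2 Ts δc M1 M2 L1 L2 : ℝ)
    (P11s P21s P23s R11s R21s R23s γ11s γ21s γ23s : ℝ)
    (hα : 0 < α) (hB1 : 0 < B1) (hB2 : 0 < B2)
    (hPb1 : 0 < Pb1) (hPb2 : 0 < Pb2) (hLb1 : 0 < Lb1) (hLb2 : 0 < Lb2)
    (hTs : 0 < Ts) (hδc : 0 < δc) (hM1 : 0 < M1) (hM2 : 0 < M2)
    (hL1 : 0 < L1) (hL2 : 0 < L2) (hL : Lb1 ≤ Lb2)
    (hfeas : FMPFeas α α B1 B2 Pb1 Pb2 Lb1 Lb2 Ts δc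
      P11s P21s P23s R11s R21s R23s γ11s γ21s γ23s)
    (hopt : ∀ P11 P21 P23 R11 R21 R23 γ11 γ21 γ23,
      FMPFeas α α B1 B2 Pb1 Pb2 Lb1 Lb2 Ts δc P11 P21 P23 R11 R21 R23 γ11 γ21 γ23 →
      FMPObj B1 B2 M1 M2 L1 L2 P11s P21s P23s R11s R21s R23s γ11s γ21s γ23s ≤
        FMPObj B1 B2 M1 M2 L1 L2 P11 P21 P23 R11 R21 R23 γ11 γ21 γ23)
    (hthr : P11s + P21s ≤ min Pb1 Pb2) :
    ∃ P1 P2 R1 R2,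
      TPFeas α α B1 B2 Pb1 Pb2 Lb1 Lb2 Ts δc P1 P2 R1 R2 γ11s (γ21s + γ23s) ∧
      TPObj B1 B2 M1 M2 L1 L2 P1 P2 R1 R2 γ11s (γ21s + γ23s) ≤
        FMPObj B1 B2 M1 M2 L1 L2 P11s P21s P23s R11s R21s R23s γ11s γ21s γ23s := by
  obtain ⟨g11, g11', g21, g23, gs, r11, r21, r23, heq, hl1, hl2, p11, p11', p21, p21', p23, p23',
    c1, c2, c3, c4⟩ := hfeas
  unfold FMPObj
  have hPA : P11s + P21s ≤ Pb1 := hthr.trans (min_le_left _ _)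
  have hPB : P11s + P21s ≤ Pb2 := hthr.trans (min_le_right _ _)
  set P := P11s + P21s with hP
  set S := R11s + R21s with hS
  have hS0 : 0 < S := by positivity
  have hP0 : 0 ≤ P := by positivity
  have c3' : S ≤ log2 (1 + α * P) := by
    have : 1 + α * P = 1 + α * P11s + α * P21s := by rw [hP]; ring
    rw [this]; exact c3
  set τ := γ11s * B1 / R11s with hτ
  have e1 : γ11s * B1 = τ * R11s := by rw [hτ]; field_simp
  have e2 : γ21s * B2 = τ * R21s := by rw [heq]; field_simp
  set v := γ23s * B2 / R23s with hv
  have e3 : γ23s * B2 = v * R23s := by rw [hv]; field_simp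
  have hτ0 : 0 ≤ τ := by positivity
  have hv0 : 0 ≤ v := by positivity
  set u := τ * R21s / S with hu
  have hu0 : 0 ≤ u := by positivity
  have et : γ11s * B1 / S + u = τ := by rw [e1, hu, hS]; field_simp
  have eu : u * S = τ * R21s := by rw [hu]; field_simp
  have hγ : (γ21s + γ23s) * B2 = u * S + v * R23s := by rw [add_mul, e2, e3, eu]
  have hl1' : Ts * (γ11s * B1 / S) + δc * γ11s * B1 ≤ Lb1 := by
    have : γ11s * B1 / S ≤ τ := by linarith
    have := mul_le_mul_of_nonneg_left this hTs.le
    linarith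
  rw [← heq] at hl2
  have hl2' : ∀ t, t = u + v → Ts * (γ11s * B1 / S) + Ts * t + δc * (γ21s + γ23s) * B2 ≤ Lb2 := by
    intro t ht
    have : γ11s * B1 / S + t = τ + v := by linarith
    have h2 : Ts * (γ11s * B1 / S) + Ts * t = Ts * (τ + v) := by rw [← this]; ring
    linarith
  have hobj : ∀ t Q, t = u + v → t * Q = u * P + v * P23s →
      (γ11s * B1 / S) * P + t * Q + (M1 / L1 ^ 2) * ((1 - γ11s) * B1) ^ 3 +
      (M2 / L2 ^ 2) * ((1 - (γ21s + γ23s)) * B2) ^ 3 ≤ 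
      τ * P + v * P23s + (M1 / L1 ^ 2) * ((1 - γ11s) * B1) ^ 3 +
      (M2 / L2 ^ 2) * ((1 - γ21s - γ23s) * B2) ^ 3 := by
    intro t Q ht hQ
    rw [hQ, ← et, sub_sub]
    apply le_of_eq; ring
  clear_value u v τ S P
  clear hopt
  rcases (add_nonneg hu0 hv0).eq_or_lt with h0 | h0
  · have hu00 : u = 0 := by linarith
    have hv00 : v = 0 := by linarith
    have ht : (γ21s + γ23s) * B2 / S = u + v := by rw [hγ, hu00, hv00]; simp
    refine ⟨P, P, S, S, ⟨g11, g11', by positivity, gs, hP0, hPA, hP0, hPB, hS0, c3', hS0, c3',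
      hl1', hl2' _ ht⟩, hobj _ _ ht ?_⟩
    rw [ht, hu00, hv00]; simp
  · have hR : 0 < (u * S + v * R23s) / (u + v) := by
      apply div_pos _ h0
      rcases hu0.eq_or_lt with h | h
      · have : 0 < v := by linarith
        positivity
      · positivity
    have hne : u * S + v * R23s ≠ 0 := by
      intro h; rw [h] at hR; simp at hR
    have ht : (γ21s + γ23s) * B2 / ((u * S + v * R23s) / (u + v)) = u + v := by
      rw [hγ]; field_simp
    refine ⟨P, (u * P + v * P23s) / (u + v), S, (u * S + v * R23s) / (u + v),
      ⟨g11, g11', by positivity, gs, hP0, hPA, by positivity, ?_, hS0, c3', hR, ?_,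
      hl1', hl2' _ ht⟩, hobj _ _ ht ?_⟩
    · rw [div_le_iff₀ h0]
      nlinarith [mul_le_mul_of_nonneg_left hPB hu0, mul_le_mul_of_nonneg_left p23' hv0]
    · have hc := strictConcaveOn_log_Ioi.concaveOn.2
        (show 1 + α * P ∈ Set.Ioi (0:ℝ) from by simp only [Set.mem_Ioi]; positivity)
        (show 1 + α * P23s ∈ Set.Ioi (0:ℝ) from by simp only [Set.mem_Ioi]; positivity)
        (show 0 ≤ u / (u + v) by positivity) (show 0 ≤ v / (u + v) by positivity)
        (by field_simp)
      simp only [smul_eq_mul] at hc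
      have hx : u / (u + v) * (1 + α * P) + v / (u + v) * (1 + α * P23s) =
          1 + α * ((u * P + v * P23s) / (u + v)) := by field_simp; ring
      rw [hx] at hc
      have hl : (0:ℝ) < Real.log 2 := Real.log_pos (by norm_num)
      unfold log2 Real.logb at c3' c4 ⊢
      rw [le_div_iff₀ hl] at c3' c4 ⊢
      refine le_trans ?_ hc
      have k1 := mul_le_mul_of_nonneg_left c3' (show 0 ≤ u / (u + v) by positivity)
      have k2 := mul_le_mul_of_nonneg_left c4 (show 0 ≤ v / (u + v) by positivity)
      refine le_trans (le_of_eq ?_) (add_le_add k1 k2)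
      field_simp
    · rw [ht]; field_simp
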